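/- arXiv:1201.1315 — 2 statements merged into one kernel-verified Lean document; each statement's English description precedes it below -/
import Mathlib

section
/- Let p be an odd prime and let f : ℤ_p → ℚ_p be continuous, and let f_1(x) := f(x+1). Then the fermionic p-adic integrals I_{−1}(f_1) and I_{−1}(f) both exist and satisfy I_{−1}(f_1) + I_{−1}(f) = 2·f(0). -/
open Filter

theorem Finset.sum_range_mul_eq_sum_sum {M : Type*} [AddCommMonoid M] (g : ℕ → M) (q m : ℕ) :
    ∑ x ∈ Finset.range (q * m), g x =
      ∑ j ∈ Finset.range m, ∑ i ∈ Finset.range q, g (q * j + i) := by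
  induction m with
  | zero => simp
  | succ m ih => rw [Nat.mul_succ, Finset.sum_range_add, ih, Finset.sum_range_succ]

theorem alternating_sum_range_mul_sub {R : Type*} [CommRing R] (g : ℕ → R) {q m : ℕ}
    (hq : Odd q) (hm : Odd m) :
    ∑ x ∈ Finset.range (q * m), (-1) ^ x * g x - ∑ x ∈ Finset.range q, (-1) ^ x * g x =
      ∑ j ∈ Finset.range m, ∑ i ∈ Finset.range q,
        (-1) ^ (q * j + i) * (g (q * j + i) - g i) := by
  have hsum : ∑ x ∈ Finset.range q, (-1) ^ x * g x =
      ∑ j ∈ Finset.range m, (-1) ^ j * ∑ x ∈ Finset.range q, (-1) ^ x * g x := by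
    rw [← Finset.sum_mul, neg_one_geom_sum, if_neg (Nat.not_even_iff_odd.mpr hm), one_mul]
  rw [Finset.sum_range_mul_eq_sum_sum, hsum, ← Finset.sum_sub_distrib]
  refine Finset.sum_congr rfl fun j _ => ?_
  rw [Finset.mul_sum, ← Finset.sum_sub_distrib]
  refine Finset.sum_congr rfl fun i _ => ?_
  rw [pow_add, pow_mul, hq.neg_one_pow]
  ring

theorem alternating_sum_range_shift_add {R : Type*} [CommRing R] (g : ℕ → R) {n : ℕ}
    (hn : Odd n) :
    ∑ x ∈ Finset.range n, (-1) ^ x * g (x + 1) + ∑ x ∈ Finset.range n, (-1) ^ x * g x =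
      g 0 + g n := by
  have h := Finset.sum_range_sub' (fun x => (-1) ^ x * g x) n
  rw [hn.neg_one_pow, pow_zero, one_mul, neg_one_mul, sub_neg_eq_add] at h
  rw [← h, ← Finset.sum_add_distrib]
  refine Finset.sum_congr rfl fun x _ => ?_
  rw [pow_succ]
  ring

theorem PadicInt.tendsto_prime_pow (p : ℕ) [Fact p.Prime] :
    Tendsto (fun N : ℕ => (p : ℤ_[p]) ^ N) atTop (nhds 0) :=
  tendsto_pow_atTop_nhds_zero_of_norm_lt_one <| by
    rw [PadicInt.norm_p]
    exact inv_lt_one_of_one_lt₀ (mod_cast (Fact.out : p.Prime).one_lt)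

theorem cauchySeq_alternating_sum_range_prime_pow {p : ℕ} [Fact p.Prime] (hp : Odd p)
    {f : ℤ_[p] → ℚ_[p]} (hf : Continuous f) :
    CauchySeq fun N : ℕ => ∑ x ∈ Finset.range (p ^ N), (-1 : ℚ_[p]) ^ x * f (x : ℤ_[p]) := by
  apply NonarchimedeanAddGroup.cauchySeq_of_tendsto_sub_nhds_zero
  rw [Metric.tendsto_atTop]
  intro ε hε
  obtain ⟨δ, hδ, hfδ⟩ := Metric.uniformContinuous_iff.mp
    (CompactSpace.uniformContinuous_of_continuous hf) (ε / 2) (half_pos hε)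
  obtain ⟨N₀, hN₀⟩ := Metric.tendsto_atTop.mp (PadicInt.tendsto_prime_pow p) δ hδ
  refine ⟨N₀, fun N hN => ?_⟩
  rw [dist_zero_right, pow_succ,
    alternating_sum_range_mul_sub (fun x : ℕ => f (x : ℤ_[p])) hp.pow hp]
  refine (IsUltrametricDist.norm_sum_le_of_forall_le_of_nonneg (half_pos hε).le fun j _ =>
    IsUltrametricDist.norm_sum_le_of_forall_le_of_nonneg (half_pos hε).le
      fun i _ => ?_).trans_lt (half_lt_self hε)
  rw [norm_mul, norm_pow, norm_neg, norm_one, one_pow, one_mul, ← dist_eq_norm]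
  refine (hfδ ?_).le
  have hpow := hN₀ N hN
  rw [dist_zero_right] at hpow
  rw [dist_eq_norm]
  push_cast
  rw [add_sub_cancel_right, norm_mul]
  exact (mul_le_of_le_one_right (norm_nonneg _) (PadicInt.norm_le_one _)).trans_lt hpow

theorem fermionic_integral_functional_equation (p : ℕ) [Fact p.Prime] (hp : p ≠ 2)
    (f : ℤ_[p] → ℚ_[p]) (hf : Continuous f) :
    ∃ L₁ L : ℚ_[p],
      Filter.Tendsto
        (fun N : ℕ => ∑ x ∈ Finset.range (p ^ N), (-1 : ℚ_[p]) ^ x * f ((x : ℤ_[p]) + 1))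
        Filter.atTop (nhds L₁) ∧
      Filter.Tendsto
        (fun N : ℕ => ∑ x ∈ Finset.range (p ^ N), (-1 : ℚ_[p]) ^ x * f (x : ℤ_[p]))
        Filter.atTop (nhds L) ∧
      L₁ + L = 2 * f 0 := by
  have hodd : Odd p := (Fact.out : p.Prime).odd_of_ne_two hp
  obtain ⟨L, hL⟩ := cauchySeq_tendsto_of_complete
    (cauchySeq_alternating_sum_range_prime_pow hodd hf)
  refine ⟨f 0 + f 0 - L, L, ?_, hL, by ring⟩
  have hpow := (hf.tendsto 0).comp (PadicInt.tendsto_prime_pow p)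
  refine ((hpow.const_add (f 0)).sub hL).congr fun N => ?_
  have h := alternating_sum_range_shift_add (fun x : ℕ => f (x : ℤ_[p])) (hodd.pow (n := N))
  push_cast at h
  rw [sub_eq_iff_eq_add, h, Function.comp_apply]
end

section
/- Let p be an odd prime, let c ∈ ℤ_p satisfy |c − 1|_p < 1, and let x₀ ∈ ℚ_p. Then for every n ∈ ℕ, the fermionic moment E_n(x₀, c) := lim_{N→∞} Σ_{x=0}^{p^N−1} (−1)^x c^x (x₀ + x)^n exists in ℚ_p and satisfies the binomial (addition) formula E_n(x₀, c) = Σ_{m=0}^{n} C(n, m)·E_m(c)·x₀^{n−m}, where E_m(c) := E_m(0, c) and C(n,m) is the binomial coefficient. -/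
open Filter

theorem sub_one_mul_sum_pow_mul_pow {R : Type*} [CommRing R] (a : R) (M n : ℕ) :
    (a - 1) * ∑ x ∈ Finset.range M, a ^ x * (x : R) ^ n =
      a ^ M * (M : R) ^ n - (0 : R) ^ n -
        a * ∑ m ∈ Finset.range n, (n.choose m : R) * ∑ x ∈ Finset.range M, a ^ x * (x : R) ^ m := by
  have telescope := Finset.sum_range_sub (fun x : ℕ => a ^ x * (x : R) ^ n) M
  have expand : ∑ x ∈ Finset.range M, a ^ x * ((x : R) + 1) ^ n =
      ∑ m ∈ Finset.range (n + 1), (n.choose m : R) *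
        ∑ x ∈ Finset.range M, a ^ x * (x : R) ^ m := by
    simp only [add_pow, one_pow, mul_one, Finset.mul_sum]
    rw [Finset.sum_comm]
    exact Finset.sum_congr rfl fun m _ => Finset.sum_congr rfl fun x _ => by ring
  rw [Finset.sum_range_succ, Nat.choose_self, Nat.cast_one, one_mul] at expand
  have shift : ∑ x ∈ Finset.range M, a ^ (x + 1) * ((x : R) + 1) ^ n =
      a * ∑ x ∈ Finset.range M, a ^ x * ((x : R) + 1) ^ n := by
    rw [Finset.mul_sum]
    exact Finset.sum_congr rfl fun x _ => by ring
  simp only [Nat.cast_add, Nat.cast_one, Nat.cast_zero, pow_zero, one_mul,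
    Finset.sum_sub_distrib, shift, expand] at telescope
  linear_combination telescope

theorem exists_tendsto_sum_pow_mul_pow {K : Type*} [Field K] [TopologicalSpace K]
    [IsTopologicalRing K] {a L : K} (ha : a ≠ 1) {M : ℕ → ℕ}
    (hM : Tendsto (fun N => (M N : K)) atTop (nhds 0))
    (haM : Tendsto (fun N => a ^ M N) atTop (nhds L)) (n : ℕ) :
    ∃ l : K, Tendsto (fun N => ∑ x ∈ Finset.range (M N), a ^ x * (x : K) ^ n)
      atTop (nhds l) := by
  induction n using Nat.strong_induction_on with
  | _ n ih =>
    choose! e he using ih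
    have lower : Tendsto (fun N => ∑ m ∈ Finset.range n, (n.choose m : K) *
        ∑ x ∈ Finset.range (M N), a ^ x * (x : K) ^ m) atTop
        (nhds (∑ m ∈ Finset.range n, (n.choose m : K) * e m)) :=
      tendsto_finsetSum _ fun m hm => (he m (Finset.mem_range.mp hm)).const_mul _
    refine ⟨_, ((((haM.mul (hM.pow n)).sub_const ((0 : K) ^ n)).sub
      (lower.const_mul a)).const_mul (a - 1)⁻¹).congr fun N => ?_⟩
    rw [← sub_one_mul_sum_pow_mul_pow, inv_mul_cancel_left₀ (sub_ne_zero.mpr ha)]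

theorem tendsto_sum_mul_add_pow {R : Type*} [CommRing R] [TopologicalSpace R]
    [IsTopologicalRing R] {w : ℕ → R} {M : ℕ → ℕ} {E : ℕ → R}
    (hE : ∀ n : ℕ, Tendsto (fun N => ∑ x ∈ Finset.range (M N), w x * (x : R) ^ n)
      atTop (nhds (E n))) (x₀ : R) (n : ℕ) :
    Tendsto (fun N => ∑ x ∈ Finset.range (M N), w x * (x₀ + (x : R)) ^ n) atTop
      (nhds (∑ m ∈ Finset.range (n + 1), (n.choose m : R) * E m * x₀ ^ (n - m))) := by
  refine (tendsto_finsetSum _ fun m _ =>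
    ((hE m).const_mul (n.choose m : R)).mul_const (x₀ ^ (n - m))).congr fun N => ?_
  simp only [add_comm x₀, add_pow, Finset.mul_sum, Finset.sum_mul]
  rw [Finset.sum_comm]
  exact Finset.sum_congr rfl fun x _ => Finset.sum_congr rfl fun m _ => by ring

theorem PadicInt.tendsto_pow_prime_pow {p : ℕ} [Fact p.Prime] {c : ℤ_[p]} (hc : ‖c - 1‖ < 1) :
    Tendsto (fun N : ℕ => c ^ p ^ N) atTop (nhds 1) := by
  have bound (N : ℕ) : ‖c ^ p ^ N - 1‖ ≤ ‖(p : ℤ_[p]) ^ (N + 1)‖ := by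
    obtain ⟨d, hd⟩ := dvd_sub_pow_of_dvd_sub ((PadicInt.norm_lt_one_iff_dvd _).mp hc) N
    rw [one_pow] at hd
    rw [hd, norm_mul]
    exact mul_le_of_le_one_right (norm_nonneg _) (PadicInt.norm_le_one d)
  refine tendsto_iff_norm_sub_tendsto_zero.mpr
    (squeeze_zero (fun _ => norm_nonneg _) bound ?_)
  have small := (tendsto_pow_atTop_nhds_zero_of_norm_lt_one
    (PadicInt.norm_lt_one_iff_dvd (p : ℤ_[p]) |>.mpr dvd_rfl)).comp (tendsto_add_atTop_nat 1)
  simpa using small.norm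

theorem PadicInt.neg_ne_one_of_norm_sub_one_lt_one {p : ℕ} [Fact p.Prime] (hp : p ≠ 2)
    {c : ℤ_[p]} (hc : ‖c - 1‖ < 1) : -c ≠ 1 := by
  intro h
  obtain rfl : c = -1 := neg_eq_iff_eq_neg.mp h
  have two_lt : ‖((2 : ℤ) : ℤ_[p])‖ < 1 := by
    rwa [← norm_neg, show -((2 : ℤ) : ℤ_[p]) = -1 - 1 by push_cast; ring]
  rw [PadicInt.norm_int_lt_one_iff_dvd] at two_lt
  exact hp ((Nat.prime_dvd_prime_iff_eq Fact.out Nat.prime_two).mp (by exact_mod_cast two_lt))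

theorem fermionic_moments_addition_formula (p : ℕ) [Fact p.Prime] (hp : p ≠ 2)
    (c : ℤ_[p]) (hc : ‖c - 1‖ < 1) (x₀ : ℚ_[p]) :
    ∃ E Ex : ℕ → ℚ_[p],
      (∀ n : ℕ, Filter.Tendsto
        (fun N : ℕ => ∑ x ∈ Finset.range (p ^ N),
          (-1 : ℚ_[p]) ^ x * ((c : ℚ_[p])) ^ x * (x : ℚ_[p]) ^ n)
        Filter.atTop (nhds (E n))) ∧
      (∀ n : ℕ, Filter.Tendsto
        (fun N : ℕ => ∑ x ∈ Finset.range (p ^ N),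
          (-1 : ℚ_[p]) ^ x * ((c : ℚ_[p])) ^ x * (x₀ + (x : ℚ_[p])) ^ n)
        Filter.atTop (nhds (Ex n))) ∧
      ∀ n : ℕ, Ex n =
        ∑ m ∈ Finset.range (n + 1), (n.choose m : ℚ_[p]) * E m * x₀ ^ (n - m) := by
  have neg_ne : -(c : ℚ_[p]) ≠ 1 := by
    intro h
    refine PadicInt.neg_ne_one_of_norm_sub_one_lt_one hp hc (PadicInt.ext ?_)
    rwa [PadicInt.coe_neg, PadicInt.coe_one]
  have length_tendsto : Tendsto (fun N : ℕ => ((p ^ N : ℕ) : ℚ_[p])) atTop (nhds 0) := by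
    simpa using tendsto_pow_atTop_nhds_zero_of_norm_lt_one (Padic.norm_p_lt_one (p := p))
  have weight_tendsto : Tendsto (fun N : ℕ => (-(c : ℚ_[p])) ^ p ^ N) atTop (nhds (-1)) := by
    have p_odd : Odd p := (Fact.out : p.Prime).odd_of_ne_two hp
    have coe_tendsto : Tendsto (fun N : ℕ => ((c ^ p ^ N : ℤ_[p]) : ℚ_[p])) atTop
        (nhds ((1 : ℤ_[p]) : ℚ_[p])) := (continuous_subtype_val.tendsto (1 : ℤ_[p])).comp
      (PadicInt.tendsto_pow_prime_pow hc)
    simpa [p_odd.pow.neg_pow] using coe_tendsto.neg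
  choose E hE using exists_tendsto_sum_pow_mul_pow neg_ne length_tendsto weight_tendsto
  simp only [← mul_pow, neg_one_mul]
  exact ⟨E, _, hE, tendsto_sum_mul_add_pow hE x₀, fun _ => rfl⟩
end
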